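/- arXiv:1008.4629 — 3 statements merged into one kernel-verified Lean document; each statement's English description precedes it below -/
import Mathlib

section
/- Let a > 0 and let c₁ ≥ 0, c₂ ≥ 0 be real constants. The function g(x) = (a·x/(1 − a·x)) · x · max(0, c₁·√x − c₂) is convex and monotone nondecreasing on the half-open interval [0, 1/a). -/
/-- The load factor `x ↦ a·x/(1 − a·x)` is convex on `[0, 1/a)`. -/
lemma convexOn_load {a : ℝ} (ha : 0 < a) :
    ConvexOn ℝ (Set.Ico (0 : ℝ) (1 / a)) (fun x => a * x / (1 - a * x)) := by
  have h := ((convexOn_zpow (𝕜 := ℝ) (-1)).comp_affineMap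
    (AffineMap.lineMap (1 : ℝ) (1 - a))).add_const (-1)
  refine (h.subset (fun x hx => ?_) (convex_Ico _ _)).congr fun x hx => ?_
  all_goals
    have hax : a * x < 1 := by
      have := (lt_div_iff₀ ha).1 hx.2
      linarith
  · simp only [Set.mem_preimage, AffineMap.lineMap_apply_ring', Set.mem_Ioi]
    linarith
  · have hne : 1 - a * x ≠ 0 := by linarith
    have heq : x * (1 - a - 1) + 1 = 1 - a * x := by ring
    simp only [Pi.add_apply, Function.comp_apply, AffineMap.lineMap_apply_ring', heq,
      zpow_neg_one]
    field_simp
    ring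

lemma monotoneOn_load {a : ℝ} (ha : 0 < a) :
    MonotoneOn (fun x => a * x / (1 - a * x)) (Set.Ico (0 : ℝ) (1 / a)) := by
  intro x hx y hy hxy
  have hy' := (lt_div_iff₀ ha).1 hy.2
  have hay : 0 ≤ a * y := mul_nonneg ha.le hy.1
  have hxy' : a * x ≤ a * y := mul_le_mul_of_nonneg_left hxy ha.le
  exact div_le_div₀ hay hxy' (by linarith) (by linarith)

/-- The function `x ↦ x·max(0, c₁·√x − c₂)` is convex on `[0, ∞)`. -/
lemma convexOn_mul_max_sqrt {c₁ : ℝ} (c₂ : ℝ) (hc₁ : 0 ≤ c₁) :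
    ConvexOn ℝ (Set.Ici (0 : ℝ)) (fun x => x * max 0 (c₁ * Real.sqrt x - c₂)) := by
  have h₁ : ConvexOn ℝ (Set.Ici (0 : ℝ)) (fun x : ℝ => c₁ • x ^ (3 / 2 : ℝ)) :=
    (convexOn_rpow (by norm_num)).smul hc₁
  have h₂ : ConvexOn ℝ (Set.Ici (0 : ℝ)) (fun x : ℝ => -c₂ * x) :=
    (LinearMap.mulLeft ℝ (-c₂)).convexOn (convex_Ici _)
  refine ((convexOn_const 0 (convex_Ici _)).sup (h₁.add h₂)).congr fun x (hx : 0 ≤ x) => ?_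
  have hpow : x ^ (3 / 2 : ℝ) = x * Real.sqrt x := by
    rw [Real.sqrt_eq_rpow, ← Real.rpow_one_add' hx (by norm_num)]
    norm_num
  simp only [Pi.sup_apply, Pi.add_apply, smul_eq_mul, hpow]
  rw [mul_max_of_nonneg _ _ hx, mul_zero]
  congr 1
  ring

lemma monotoneOn_mul_max_sqrt {c₁ : ℝ} (c₂ : ℝ) (hc₁ : 0 ≤ c₁) :
    MonotoneOn (fun x => x * max 0 (c₁ * Real.sqrt x - c₂)) (Set.Ici (0 : ℝ)) := by
  intro x _ y hy hxy
  have : (0 : ℝ) ≤ y := hy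
  dsimp only
  gcongr


/-- Combined convexity claim in the proof of Theorem 4:
`g(x) = (a·x/(1 − a·x)) · x · max(0, c₁·√x − c₂)` is convex and nondecreasing
on `[0, 1/a)` for `a > 0`, `c₁, c₂ ≥ 0`. -/
theorem load_times_travel_convex_monotone
    (a c₁ c₂ : ℝ) (ha : 0 < a) (hc₁ : 0 ≤ c₁) (hc₂ : 0 ≤ c₂) :
    ConvexOn ℝ (Set.Ico (0 : ℝ) (1 / a))
        (fun x => a * x / (1 - a * x) * x * max 0 (c₁ * Real.sqrt x - c₂)) ∧
      MonotoneOn (fun x => a * x / (1 - a * x) * x * max 0 (c₁ * Real.sqrt x - c₂))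
        (Set.Ico (0 : ℝ) (1 / a)) := by
  have hsub : Set.Ico (0 : ℝ) (1 / a) ⊆ Set.Ici 0 := Set.Ico_subset_Ici_self
  have hf₀ : ∀ ⦃x⦄, x ∈ Set.Ico (0 : ℝ) (1 / a) → 0 ≤ a * x / (1 - a * x) := fun x hx => by
    have := (lt_div_iff₀ ha).1 hx.2
    exact div_nonneg (mul_nonneg ha.le hx.1) (by linarith)
  have hg₀ : ∀ ⦃x⦄, x ∈ Set.Ico (0 : ℝ) (1 / a) →
      0 ≤ x * max 0 (c₁ * Real.sqrt x - c₂) :=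
    fun x hx => mul_nonneg hx.1 (le_max_left _ _)
  have hf := monotoneOn_load ha
  have hg := (monotoneOn_mul_max_sqrt c₂ hc₁).mono hsub
  simp only [mul_assoc _ _ (max _ _)]
  exact ⟨(convexOn_load ha).mul ((convexOn_mul_max_sqrt c₂ hc₁).subset hsub (convex_Ico _ _))
    hf₀ hg₀ (hf.monovaryOn hg), hf.mul hg hf₀ hg₀⟩
end

section
/- Let s > 0 and let (A_n)_{n≥1} and (D_n)_{n≥1} be sequences of real numbers satisfying: (i) A_n + s ≤ D_n for every n ≥ 1, and (ii) D_n + s ≤ D_{n+1} for every n ≥ 1. Define the sequence (D'_n)_{n≥1} recursively by D'_1 = A_1 + s and D'_{n+1} = max(A_{n+1}, D'_n) + s. Then D'_n ≤ D_n for every n ≥ 1; consequently, for every real t, the set {n : A_n ≤ t < D'_n} is contained in the set {n : A_n ≤ t < D_n}, so at every time t the number of messages present in the primed system is at most the number present in the original system. -/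
/-- Sample-path dominance (Lemma 1): if in the original system each message `n`
departs at time `D n` with `A n + s ≤ D n` (service takes time `s` after arrival)
and `D n + s ≤ D (n+1)` (receptions cannot overlap), and `D'` is the departure
process of the infinite-velocity FCFS single-server system with constant service
time `s` (`D' 0 = A 0 + s`, `D' (n+1) = max (A (n+1)) (D' n) + s`), then
`D' n ≤ D n` for all `n`; consequently at every time `t` the set of messages
present in the primed system is contained in that of the original system. -/
theorem infinite_velocity_dominance
    (s : ℝ) (hs : 0 < s) (A D D' : ℕ → ℝ)
    (hAD : ∀ n, A n + s ≤ D n)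
    (hDD : ∀ n, D n + s ≤ D (n + 1))
    (hD'0 : D' 0 = A 0 + s)
    (hD'succ : ∀ n, D' (n + 1) = max (A (n + 1)) (D' n) + s) :
    (∀ n, D' n ≤ D n) ∧
      ∀ t : ℝ, {n | A n ≤ t ∧ t < D' n} ⊆ {n | A n ≤ t ∧ t < D n} := by
  have dominated : ∀ n, D' n ≤ D n := by
    intro n
    induction n with
    | zero => exact hD'0.trans_le (hAD 0)
    | succ n ih =>
      rw [hD'succ, ← max_add_add_right]
      exact max_le (hAD (n + 1)) ((add_le_add_left ih s).trans (hDD n))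
  exact ⟨dominated, fun _ n hn => ⟨hn.1, hn.2.trans_le (dominated n)⟩⟩
end

section
/- Let a > 0 and let Q = [−a, a] × [−a, a] ⊂ ℝ² be a square centered at the origin, equipped with the Euclidean norm and two-dimensional Lebesgue measure. Then for every point p ∈ ℝ², ∫_Q ‖x − p‖ dx ≥ ∫_Q ‖x‖ dx. That is, the center of the square minimizes, over all points p of the plane, the expected Euclidean distance from p to a uniformly distributed point in the square. -/
open MeasureTheory

/-- If `s` is symmetric about the origin and `μ` is invariant under negation, then the origin
minimizes `p ↦ ∫ x in s, ‖x - p‖ ∂μ`. -/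
theorem setIntegral_norm_le_setIntegral_norm_sub {E : Type*} [NormedAddCommGroup E]
    [NormedSpace ℝ E] [MeasurableSpace E] [BorelSpace E] {μ : Measure E} [μ.IsNegInvariant]
    {s : Set E} (hs : -s = s) (h : ∀ p : E, IntegrableOn (fun x => ‖x - p‖) s μ) (p : E) :
    ∫ x in s, ‖x‖ ∂μ ≤ ∫ x in s, ‖x - p‖ ∂μ := by
  have reflect : ∫ x in s, ‖x - -p‖ ∂μ = ∫ x in s, ‖x - p‖ ∂μ := by
    have := (Measure.measurePreserving_neg μ).setIntegral_preimage_emb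
      (MeasurableEquiv.neg E).measurableEmbedding (fun x => ‖x - p‖) s
    rw [← this, Set.neg_preimage, hs]
    refine integral_congr_ae (.of_forall fun x => ?_)
    change ‖x - -p‖ = ‖-x - p‖
    rw [← norm_neg]
    congr 1
    abel
  have midpoint_le (x : E) : 2 * ‖x‖ ≤ ‖x - p‖ + ‖x - -p‖ := by
    calc 2 * ‖x‖ = ‖(2 : ℝ) • x‖ := by rw [norm_smul, Real.norm_ofNat]
      _ = ‖(x - p) + (x - -p)‖ := by congr 1; rw [two_smul]; abel
      _ ≤ _ := norm_add_le _ _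
  have h0 : IntegrableOn (fun x => ‖x‖) s μ := by simpa using h 0
  have := integral_mono (h0.const_mul 2) ((h p).add (h (-p))) midpoint_le
  rw [integral_const_mul, integral_add' (h p) (h (-p)), reflect] at this
  linarith

theorem isCompact_square (a : ℝ) :
    IsCompact {x : EuclideanSpace ℝ (Fin 2) | x 0 ∈ Set.Icc (-a) a ∧ x 1 ∈ Set.Icc (-a) a} := by
  have := (EuclideanSpace.equiv (Fin 2) ℝ).toHomeomorph.isCompact_preimage.2
    (isCompact_univ_pi fun _ : Fin 2 => isCompact_Icc (a := -a) (b := a))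
  convert this using 1
  ext x
  simp [Pi.le_def, Fin.forall_fin_two, and_and_and_comm]

/-- The center of a square minimizes the expected Euclidean distance to a
uniformly distributed point of the square: for the square
`Q = [−a, a] × [−a, a]` centered at the origin and any `p ∈ ℝ²`,
`∫_Q ‖x − p‖ dx ≥ ∫_Q ‖x‖ dx`. -/
theorem center_is_median_of_square (a : ℝ) (ha : 0 < a)
    (p : EuclideanSpace ℝ (Fin 2)) :
    (∫ x in {x : EuclideanSpace ℝ (Fin 2) |
        x 0 ∈ Set.Icc (-a) a ∧ x 1 ∈ Set.Icc (-a) a}, ‖x‖) ≤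
      ∫ x in {x : EuclideanSpace ℝ (Fin 2) |
        x 0 ∈ Set.Icc (-a) a ∧ x 1 ∈ Set.Icc (-a) a}, ‖x - p‖ := by
  refine setIntegral_norm_le_setIntegral_norm_sub ?_ (fun q => ?_) p
  · ext x
    simp only [Set.mem_neg, Set.mem_ofPred_eq, PiLp.neg_apply, Set.mem_Icc, neg_le_neg_iff,
      neg_le (a := x _)]
    tauto
  · exact (by fun_prop : Continuous fun x => ‖x - q‖).continuousOn.integrableOn_compact
      (isCompact_square a)
end
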